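/- arXiv:1912.10840 — 2 statements merged into one kernel-verified Lean document; each statement's English description precedes it below -/
import Mathlib

section
/- Let A be a real n×m matrix of full row rank written in thin SVD form A = U Sₙ Vₙ*, where U is an n×n orthogonal matrix, Vₙ is an m×n matrix with Vₙ*Vₙ = Idₙ, and Sₙ is an n×n invertible diagonal matrix with positive diagonal entries. Let B be a symmetric positive definite n×n matrix and let C₀ = Vₙ C_V Vₙ* where C_V is a symmetric positive definite n×n matrix. Set B̃ := U*BU. Then (B + A C₀ A*) is invertible, the matrix B̃ (C_V Sₙ)⁻¹ + Sₙ is invertible, and the MAP (posterior mean) matrix satisfies the identity C₀ A* (B + A C₀ A*)⁻¹ = Vₙ Σ U*, where Σ = [B̃ (C_V Sₙ)⁻¹ + Sₙ]⁻¹. In particular, for every ỹ ∈ ℝⁿ the MAP estimate x_MAP = C₀ A*(B + A C₀ A*)⁻¹ ỹ equals Vₙ Σ U* ỹ. -/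
open Matrix

/-- MAP estimate for a linear Gaussian inverse problem written via the thin SVD:
`C₀ A* (B + A C₀ A*)⁻¹ = Vₙ Σ U*` with `Σ = [B̃ (C_V Sₙ)⁻¹ + Sₙ]⁻¹`, `B̃ = U* B U`. -/
theorem map_estimate_thin_svd (n m : ℕ)
    (A : Matrix (Fin n) (Fin m) ℝ)
    (U : Matrix (Fin n) (Fin n) ℝ)
    (Vn : Matrix (Fin m) (Fin n) ℝ)
    (s : Fin n → ℝ)
    (B CV : Matrix (Fin n) (Fin n) ℝ)
    (hU₁ : Uᵀ * U = 1) (hU₂ : U * Uᵀ = 1)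
    (hVn : Vnᵀ * Vn = 1)
    (hs : ∀ i, 0 < s i)
    (hA : A = U * Matrix.diagonal s * Vnᵀ)
    (hB : B.PosDef) (hCV : CV.PosDef) :
    let Sn : Matrix (Fin n) (Fin n) ℝ := Matrix.diagonal s
    let C₀ : Matrix (Fin m) (Fin m) ℝ := Vn * CV * Vnᵀ
    let Btilde : Matrix (Fin n) (Fin n) ℝ := Uᵀ * B * U
    let Sc : Matrix (Fin n) (Fin n) ℝ := (Btilde * (CV * Sn)⁻¹ + Sn)⁻¹
    IsUnit (B + A * C₀ * Aᵀ) ∧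
    IsUnit (Btilde * (CV * Sn)⁻¹ + Sn) ∧
    C₀ * Aᵀ * (B + A * C₀ * Aᵀ)⁻¹ = Vn * Sc * Uᵀ ∧
    ∀ ytilde : Fin n → ℝ,
      (C₀ * Aᵀ * (B + A * C₀ * Aᵀ)⁻¹).mulVec ytilde = (Vn * Sc * Uᵀ).mulVec ytilde := by
  intro Sn C₀ Btilde Sc
  have hSn : IsUnit Sn := (Matrix.PosDef.diagonal hs).isUnit
  have hP : IsUnit (CV * Sn) := hCV.isUnit.mul hSn
  have hPdet : IsUnit (CV * Sn).det := (Matrix.isUnit_iff_isUnit_det _).1 hP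
  have hUu : IsUnit U := ⟨⟨U, Uᵀ, hU₂, hU₁⟩, rfl⟩
  have hUt : IsUnit Uᵀ := ⟨⟨Uᵀ, U, hU₁, hU₂⟩, rfl⟩
  have hAt : Aᵀ = Vn * Sn * Uᵀ := by
    simp [hA, Sn, Matrix.transpose_mul, Matrix.mul_assoc]
  have hgain : C₀ * Aᵀ = Vn * (CV * Sn) * Uᵀ := by
    calc C₀ * Aᵀ = Vn * CV * (Vnᵀ * Vn) * Sn * Uᵀ := by
          simp only [hAt, C₀, Matrix.mul_assoc]
      _ = Vn * (CV * Sn) * Uᵀ := by simp only [hVn, Matrix.mul_one, Matrix.mul_assoc]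
  have hM : IsUnit (B + A * C₀ * Aᵀ) := by
    have hC : C₀.PosSemidef := by
      simpa [C₀] using hCV.posSemidef.mul_mul_conjTranspose_same Vn
    have hACA : (A * C₀ * Aᵀ).PosSemidef := by
      simpa using hC.mul_mul_conjTranspose_same A
    exact (hB.add_posSemidef hACA).isUnit
  have hfactor : B + A * C₀ * Aᵀ = U * (Btilde * (CV * Sn)⁻¹ + Sn) * (CV * Sn) * Uᵀ := by
    have hT : (Btilde * (CV * Sn)⁻¹ + Sn) * (CV * Sn) = Btilde + Sn * (CV * Sn) := by
      rw [Matrix.add_mul, Matrix.mul_assoc Btilde, Matrix.nonsing_inv_mul _ hPdet,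
        Matrix.mul_one]
    have hB' : U * Btilde * Uᵀ = B := by
      calc U * Btilde * Uᵀ = (U * Uᵀ) * B * (U * Uᵀ) := by
            simp only [Btilde, Matrix.mul_assoc]
        _ = B := by rw [hU₂, Matrix.one_mul, Matrix.mul_one]
    have hACA : A * C₀ * Aᵀ = U * (Sn * (CV * Sn)) * Uᵀ := by
      calc A * C₀ * Aᵀ = U * Sn * (Vnᵀ * Vn) * (CV * Sn) * Uᵀ := by
            rw [Matrix.mul_assoc, hgain, hA]
            simp only [Sn, Matrix.mul_assoc]
        _ = U * (Sn * (CV * Sn)) * Uᵀ := by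
            simp only [hVn, Matrix.mul_one, Matrix.mul_assoc]
    rw [Matrix.mul_assoc U, hT, Matrix.mul_add, Matrix.add_mul, hB', hACA]
  have hTu : IsUnit (Btilde * (CV * Sn)⁻¹ + Sn) := by
    have h := hM
    rwa [hfactor, hUt.mul_right_iff, hP.mul_right_iff, hUu.mul_left_iff] at h
  have hTdet := (Matrix.isUnit_iff_isUnit_det _).1 hTu
  have hMdet := (Matrix.isUnit_iff_isUnit_det _).1 hM
  have hid : C₀ * Aᵀ * (B + A * C₀ * Aᵀ)⁻¹ = Vn * Sc * Uᵀ := by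
    have h : C₀ * Aᵀ = Vn * Sc * Uᵀ * (B + A * C₀ * Aᵀ) := by
      calc C₀ * Aᵀ = Vn * (Sc * (Btilde * (CV * Sn)⁻¹ + Sn)) * (CV * Sn) * Uᵀ := by
            rw [Matrix.nonsing_inv_mul _ hTdet, Matrix.mul_one, hgain]
        _ = Vn * Sc * (Uᵀ * U) * (Btilde * (CV * Sn)⁻¹ + Sn) * (CV * Sn) * Uᵀ := by
            rw [hU₁, Matrix.mul_one, Matrix.mul_assoc Vn Sc]
        _ = Vn * Sc * Uᵀ * (B + A * C₀ * Aᵀ) := by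
            rw [hfactor]
            simp only [Matrix.mul_assoc]
    rw [h, Matrix.mul_nonsing_inv_cancel_right _ _ hMdet]
  exact ⟨hM, hTu, hid, fun y => by rw [hid]⟩
end

section
/- Let k ≥ 1, let F : ℝ^k → ℝ^k be continuous, and let 0 ≤ ε < 1. Assume that for all z with ‖z‖ ≤ 1 one has ‖z − F(z)‖ < ε. Then the closed ball B_{1−ε} of radius 1−ε centred at 0 is contained in the image F(B₁) of the closed unit ball, i.e. for every w ∈ ℝ^k with ‖w‖ ≤ 1−ε there exists z with ‖z‖ ≤ 1 and F(z) = w. -/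
section Brouwer

open MeasureTheory Metric Set Module

variable {E : Type*}

theorem exists_polynomial_eval_eq_det_one_add_smul [NormedAddCommGroup E] [NormedSpace ℝ E]
    [FiniteDimensional ℝ E] (A : E →L[ℝ] E) :
    ∃ p : Polynomial ℝ, p.natDegree ≤ finrank ℝ E ∧ ∀ t : ℝ, p.eval t = (1 + t • A).det := by
  let b := finBasis ℝ E
  let M := LinearMap.toMatrix b b (A : E →ₗ[ℝ] E)
  refine ⟨((Polynomial.X : Polynomial ℝ) • M.map Polynomial.C +
    (1 : Matrix (Fin (finrank ℝ E)) (Fin (finrank ℝ E)) ℝ).map Polynomial.C).det, ?_, fun t => ?_⟩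
  · simpa using Polynomial.natDegree_det_X_add_C_le M 1
  · rw [← Polynomial.coe_evalRingHom, RingHom.map_det, ContinuousLinearMap.det,
      ← LinearMap.det_toMatrix b]
    congr 1
    ext i j
    simp [M, Matrix.one_apply, LinearMap.toMatrix_apply, Finsupp.single_apply, apply_ite, eq_comm]
    split_ifs <;> ring

theorem det_one_add_eq_sum_lagrange [NormedAddCommGroup E] [NormedSpace ℝ E]
    [FiniteDimensional ℝ E] {T : Finset ℝ} (hT : finrank ℝ E < T.card) (A : E →L[ℝ] E) :
    (1 + A).det = ∑ t ∈ T, (1 + t • A).det * (Lagrange.basis T id t).eval 1 := by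
  obtain ⟨p, hp, hpe⟩ := exists_polynomial_eval_eq_det_one_add_smul A
  have hdeg : p.degree < T.card :=
    (Polynomial.degree_le_of_natDegree_le hp).trans_lt (by exact_mod_cast hT)
  have key := congrArg (Polynomial.eval 1)
    (Lagrange.eq_interpolate (v := id) (injOn_id _) hdeg)
  rw [Lagrange.interpolate_apply, Polynomial.eval_finsetSum, hpe, one_smul] at key
  simpa [hpe] using key

theorem LipschitzWith.injective_id_add [NormedAddCommGroup E] {φ : E → E} {K : NNReal}
    (hφ : LipschitzWith K φ) (hK : K < 1) : Function.Injective fun x => x + φ x := by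
  intro x y hxy
  have h1 := hφ.norm_sub_le x y
  have h2 : φ x - φ y = -(x - y) := by
    have : x + φ x = y + φ y := hxy
    rw [neg_sub, sub_eq_sub_iff_add_eq_add, add_comm, this]
  rw [h2, norm_neg] at h1
  have hK' : (K : ℝ) < 1 := hK
  have : ‖x - y‖ = 0 := by nlinarith [norm_nonneg (x - y)]
  exact sub_eq_zero.1 (norm_eq_zero.1 this)

theorem LipschitzWith.surjective_id_add [NormedAddCommGroup E] [CompleteSpace E]
    {φ : E → E} {K : NNReal} (hφ : LipschitzWith K φ) (hK : K < 1) :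
    Function.Surjective fun x => x + φ x := by
  intro y
  have hc : ContractingWith K fun x => y - φ x := by
    refine ⟨hK, LipschitzWith.of_dist_le_mul fun a b => ?_⟩
    rw [dist_sub_left]
    exact hφ.dist_le_mul a b
  refine ⟨hc.fixedPoint, ?_⟩
  have := hc.fixedPoint_isFixedPt
  exact eq_sub_iff_add_eq.1 this.symm

theorem LipschitzWith.image_id_add_eq [NormedAddCommGroup E] [CompleteSpace E]
    {φ : E → E} {K : NNReal} (hφ : LipschitzWith K φ) (hK : K < 1) {s : Set E}
    (hs : ∀ x ∉ s, φ x = 0) : (fun x => x + φ x) '' s = s := by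
  ext y
  constructor
  · rintro ⟨x, hx, rfl⟩
    by_contra hy
    have hxy := hφ.injective_id_add hK (a₁ := x + φ x) (a₂ := x) (by simp [hs _ hy])
    simp only [hxy] at hy
    exact hy hx
  · intro hy
    obtain ⟨x, rfl⟩ := hφ.surjective_id_add hK y
    refine ⟨x, ?_, rfl⟩
    by_contra hx
    simp [hs x hx, hx] at hy

/-- A Lipschitz map vanishing on the unit sphere, cut off outside the unit ball, is Lipschitz. -/
theorem LipschitzOnWith.indicator_ball [NormedAddCommGroup E] [NormedSpace ℝ E]
    {g : E → E} {C : NNReal} (hg : LipschitzOnWith C g (closedBall 0 1))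
    (h0 : ∀ x, ‖x‖ = 1 → g x = 0) : LipschitzWith (2 * C) ((ball (0 : E) 1).indicator g) := by
  have key : ∀ x y : E, ‖x‖ < 1 → 1 ≤ ‖y‖ → ‖g x‖ ≤ 2 * C * ‖x - y‖ := by
    intro x y hx hy
    have hy0 : ‖y‖ ≠ 0 := by linarith
    have hz : ‖‖y‖⁻¹ • y‖ = 1 := by simp [norm_smul, hy0]
    have h1 := hg.norm_sub_le (x := x) (y := ‖y‖⁻¹ • y) (by simpa using hx.le) (by simp [hz])
    rw [h0 _ hz, sub_zero] at h1
    have h2 : ‖y - ‖y‖⁻¹ • y‖ = ‖y‖ - 1 := by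
      have : y - ‖y‖⁻¹ • y = ((‖y‖ - 1) * ‖y‖⁻¹) • y := by
        rw [sub_mul, sub_smul, mul_inv_cancel₀ hy0, one_smul, one_mul]
      rw [this, norm_smul, norm_mul, norm_inv, norm_norm, Real.norm_of_nonneg (by linarith)]
      field_simp
    have h3 : ‖x - ‖y‖⁻¹ • y‖ ≤ ‖x - y‖ + (‖y‖ - 1) := by
      rw [← h2]; exact norm_sub_le_norm_sub_add_norm_sub _ _ _
    have h4 : ‖y‖ - ‖x‖ ≤ ‖x - y‖ := by rw [norm_sub_rev]; exact norm_sub_norm_le _ _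
    calc ‖g x‖ ≤ C * ‖x - ‖y‖⁻¹ • y‖ := h1
      _ ≤ C * (2 * ‖x - y‖) := by gcongr; linarith
      _ = _ := by ring
  refine LipschitzWith.of_dist_le_mul fun x y => ?_
  rw [dist_eq_norm, dist_eq_norm]
  push_cast
  by_cases hx : ‖x‖ < 1 <;> by_cases hy : ‖y‖ < 1
  · rw [indicator_of_mem (by simpa using hx), indicator_of_mem (by simpa using hy)]
    have := hg.norm_sub_le (x := x) (y := y) (by simpa using hx.le) (by simpa using hy.le)
    nlinarith [mul_nonneg C.coe_nonneg (norm_nonneg (x - y))]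
  · rw [indicator_of_mem (by simpa using hx), indicator_of_notMem (by simpa using hy), sub_zero]
    exact key x y hx (not_lt.1 hy)
  · rw [indicator_of_notMem (by simpa using hx), indicator_of_mem (by simpa using hy), zero_sub,
      norm_neg, norm_sub_rev]
    exact key y x hy (not_lt.1 hx)
  · rw [indicator_of_notMem (by simpa using hx), indicator_of_notMem (by simpa using hy)]
    simp only [sub_self, norm_zero]
    positivity

theorem integral_det_one_add_fderiv [NormedAddCommGroup E] [NormedSpace ℝ E]
    [FiniteDimensional ℝ E] [MeasurableSpace E] [BorelSpace E] (μ : Measure E)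
    [μ.IsAddHaarMeasure] {φ : E → E} {φ' : E → E →L[ℝ] E} {K : NNReal}
    (hφ : LipschitzWith K φ) (hK : K < 1) {s : Set E} (hsm : MeasurableSet s) (hμ : μ s ≠ ⊤)
    (hs : ∀ x ∉ s, φ x = 0) (hd : ∀ x ∈ s, HasFDerivWithinAt φ (φ' x) s x)
    (hpos : ∀ x ∈ s, 0 < (1 + φ' x).det) :
    IntegrableOn (fun x => (1 + φ' x).det) s μ ∧
      ∫ x in s, (1 + φ' x).det ∂μ = μ.real s := by
  have : CompleteSpace E := FiniteDimensional.complete ℝ E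
  have hd' : ∀ x ∈ s, HasFDerivWithinAt (fun x => x + φ x) (1 + φ' x) s x :=
    fun x hx => (hasFDerivWithinAt_id x s).add (hd x hx)
  have hinj := (hφ.injective_id_add hK).injOn (s := s)
  have himg := hφ.image_id_add_eq hK hs
  have habs : EqOn (fun x => |(1 + φ' x).det| • (1 : ℝ)) (fun x => (1 + φ' x).det) s :=
    fun x hx => by simp [abs_of_pos (hpos x hx)]
  have h1 := integrableOn_image_iff_integrableOn_abs_det_fderiv_smul μ hsm hd' hinj
    (fun _ => (1 : ℝ))
  have h2 := integral_image_eq_integral_abs_det_fderiv_smul μ hsm hd' hinj (fun _ => (1 : ℝ))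
  rw [himg] at h1 h2
  rw [integrableOn_congr_fun habs hsm] at h1
  rw [setIntegral_congr_fun hsm habs] at h2
  exact ⟨h1.1 (integrableOn_const hμ), by rw [← h2]; simp⟩

theorem det_fderiv_eq_zero_of_norm_eq_one [NormedAddCommGroup E] [InnerProductSpace ℝ E]
    [FiniteDimensional ℝ E] {r : E → E} {x : E} (hd : DifferentiableAt ℝ r x)
    (h1 : ∀ᶠ y in nhds x, ‖r y‖ = 1) : (fderiv ℝ r x).det = 0 := by
  have horth : ∀ v, inner ℝ (r x) (fderiv ℝ r x v) = 0 := by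
    intro v
    have h2 : HasFDerivAt (fun y => inner ℝ (r y) (r y)) (0 : E →L[ℝ] ℝ) x := by
      refine (hasFDerivAt_const (1 : ℝ) x).congr_of_eventuallyEq ?_
      filter_upwards [h1] with y hy
      rw [real_inner_self_eq_norm_sq, hy, one_pow]
    have h3 := congrArg (fun L : E →L[ℝ] ℝ => L v)
      ((hd.hasFDerivAt.inner ℝ hd.hasFDerivAt).unique h2)
    simpa [real_inner_comm] using h3
  by_contra hdet
  have hu : IsUnit (LinearMap.det (fderiv ℝ r x : E →ₗ[ℝ] E)) := isUnit_iff_ne_zero.2 hdet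
  obtain ⟨v, hv⟩ := ((LinearEquiv.ofIsUnitDet (f := (fderiv ℝ r x : E →ₗ[ℝ] E))
    (v := finBasis ℝ E) (v' := finBasis ℝ E) (by rwa [LinearMap.det_toMatrix])).surjective (r x))
  have h4 := horth v
  have hv' : fderiv ℝ r x v = r x := hv
  rw [hv', real_inner_self_eq_norm_sq, h1.self_of_nhds] at h4
  norm_num at h4

/-- There is no continuously differentiable retraction of the closed unit ball onto the sphere. -/
theorem no_contDiffOn_retraction_closedBall [NormedAddCommGroup E] [InnerProductSpace ℝ E]
    [FiniteDimensional ℝ E] {r : E → E} (hr : ContDiffOn ℝ 1 r (closedBall 0 1))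
    (h1 : ∀ x, ‖x‖ ≤ 1 → ‖r x‖ = 1) (hid : ∀ x, ‖x‖ = 1 → r x = x) : False := by
  borelize E
  let μ : Measure E := Measure.addHaar
  obtain ⟨C, hC⟩ := (hr.sub contDiffOn_id).exists_lipschitzOnWith one_ne_zero
    (convex_closedBall (0 : E) 1) (isCompact_closedBall 0 1)
  have hnhds : ∀ x ∈ ball (0 : E) 1, closedBall (0 : E) 1 ∈ nhds x := fun x hx =>
    Filter.mem_of_superset (isOpen_ball.mem_nhds hx) ball_subset_closedBall
  have hdr : ∀ x ∈ ball (0 : E) 1, DifferentiableAt ℝ r x := fun x hx =>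
    (hr.differentiableOn one_ne_zero).differentiableAt (hnhds x hx)
  let A : E → E →L[ℝ] E := fun x => fderiv ℝ (fun y => r y - y) x
  have hA : ∀ x ∈ ball (0 : E) 1, ‖A x‖ ≤ C := fun x hx =>
    norm_fderiv_le_of_lipschitzOn ℝ (hnhds x hx) hC
  have hA1 : ∀ x ∈ ball (0 : E) 1, (1 + A x).det = 0 := by
    intro x hx
    have : A x = fderiv ℝ r x - 1 := by
      simp only [A]
      rw [fderiv_fun_sub (hdr x hx) differentiableAt_fun_id, fderiv_fun_id]
      rfl
    rw [this, add_sub_cancel]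
    refine det_fderiv_eq_zero_of_norm_eq_one (hdr x hx) ?_
    filter_upwards [hnhds x hx] with y hy using h1 y (by simpa using hy)
  have hLip := hC.indicator_ball fun x hx => by simp [hid x hx]
  obtain ⟨δ, hδ, hdet⟩ : ∃ δ > 0, ∀ B : E →L[ℝ] E, ‖B‖ < δ → 0 < (1 + B).det := by
    have hc : Continuous fun B : E →L[ℝ] E => (1 + B).det :=
      ContinuousLinearMap.continuous_det.comp (by fun_prop)
    have : ∀ᶠ B in nhds (0 : E →L[ℝ] E), 0 < (1 + B).det :=
      hc.continuousAt.eventually (lt_mem_nhds (by simp [ContinuousLinearMap.det]))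
    obtain ⟨δ, hδ, h⟩ := Metric.eventually_nhds_iff.1 this
    exact ⟨δ, hδ, fun B hB => h (by simpa using hB)⟩
  have hsmall : ∃ τ > (0 : ℝ), ∀ t ∈ Ioo 0 τ, t * (2 * C) < 1 ∧ t * C < δ := by
    refine ⟨min (1 / (2 * C + 1)) (δ / (2 * C + 1)), by positivity, fun t ht => ?_⟩
    have hC0 := C.coe_nonneg
    have h2 := (lt_div_iff₀ (by positivity)).1 (lt_min_iff.1 ht.2).1
    have h3 := (lt_div_iff₀ (by positivity)).1 (lt_min_iff.1 ht.2).2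
    have ht0 := ht.1
    constructor <;> nlinarith [mul_nonneg ht0.le hC0]
  obtain ⟨τ, hτ, hsmall⟩ := hsmall
  have hint : ∀ t ∈ Ioo 0 τ, IntegrableOn (fun x => (1 + t • A x).det) (ball 0 1) μ ∧
      ∫ x in ball 0 1, (1 + t • A x).det ∂μ = μ.real (ball 0 1) := by
    intro t ht
    obtain ⟨hK, hδt⟩ := hsmall t ht
    refine integral_det_one_add_fderiv μ (K := ‖t‖₊ * (2 * C))
      (φ := fun x => t • (ball (0 : E) 1).indicator (r - id) x) ?_ ?_ measurableSet_ball
      measure_ball_lt_top.ne ?_ ?_ ?_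
    · refine LipschitzWith.of_dist_le_mul fun x y => ?_
      rw [dist_smul₀, NNReal.coe_mul, coe_nnnorm, mul_assoc]
      exact mul_le_mul_of_nonneg_left (hLip.dist_le_mul x y) (norm_nonneg _)
    · rw [← NNReal.coe_lt_coe]
      simpa [abs_of_pos ht.1] using hK
    · intro x hx
      simp [indicator_of_notMem hx]
    · intro x hx
      have hd : HasFDerivAt (fun y => r y - y) (A x) x :=
        ((hdr x hx).sub differentiableAt_id).hasFDerivAt
      refine ((hd.const_smul t).hasFDerivWithinAt).congr (fun y hy => ?_) ?_
      · simp [indicator_of_mem hy]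
      · simp [indicator_of_mem hx]
    · intro x hx
      refine hdet _ (lt_of_le_of_lt ?_ hδt)
      rw [norm_smul, Real.norm_of_nonneg ht.1.le]
      exact mul_le_mul_of_nonneg_left (hA x hx) ht.1.le
  obtain ⟨T, hTsub, hTcard⟩ := (Ioo_infinite hτ).exists_subset_card_eq (finrank ℝ E + 1)
  have hTc : finrank ℝ E < T.card := by omega
  have hsum : ∫ x in ball 0 1, (1 + A x).det ∂μ =
      ∑ t ∈ T, μ.real (ball 0 1) * (Lagrange.basis T id t).eval 1 := by
    rw [funext fun x => det_one_add_eq_sum_lagrange hTc (A x),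
      integral_finsetSum _ fun t ht => (hint t (hTsub ht)).1.mul_const _]
    refine Finset.sum_congr rfl fun t ht => ?_
    rw [integral_mul_const, (hint t (hTsub ht)).2]
  rw [setIntegral_congr_fun measurableSet_ball hA1, ← Finset.mul_sum, ← Polynomial.eval_finsetSum,
    Lagrange.sum_basis (injOn_id _) (Finset.card_pos.1 (by omega))] at hsum
  have hpos : 0 < μ.real (ball (0 : E) 1) :=
    ENNReal.toReal_pos (measure_ball_pos μ _ one_pos).ne' measure_ball_lt_top.ne
  simp at hsum
  exact hpos.ne hsum

theorem exists_fixedPoint_of_contDiff [NormedAddCommGroup E] [InnerProductSpace ℝ E]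
    [FiniteDimensional ℝ E] {f : E → E} (hf : ContDiff ℝ 1 f) (h1 : ∀ x, ‖x‖ ≤ 1 → ‖f x‖ < 1) :
    ∃ x, ‖x‖ ≤ 1 ∧ f x = x := by
  by_contra! hne
  let u : E → E := fun x => x - f x
  have hu : ContDiff ℝ 1 u := contDiff_id.sub hf
  have hu0 : ∀ x, ‖x‖ ≤ 1 → 0 < ‖u x‖ ^ 2 := fun x hx => by
    have := norm_pos_iff.2 (sub_ne_zero.2 (hne x hx).symm)
    positivity
  have hxu : ∀ x, ‖x‖ = 1 → 0 < inner ℝ x (u x) := fun x hx => by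
    have h2 := real_inner_le_norm x (f x)
    have h3 := h1 x hx.le
    rw [inner_sub_right, real_inner_self_eq_norm_sq, hx]
    rw [hx] at h2
    linarith
  let D : E → ℝ := fun x => inner ℝ x (u x) ^ 2 + ‖u x‖ ^ 2 * (1 - ‖x‖ ^ 2)
  have hD : ContDiff ℝ 1 D := by
    have := contDiff_id.inner ℝ hu
    have := hu.norm_sq ℝ
    have := (contDiff_id (𝕜 := ℝ) (E := E) (n := 1)).norm_sq ℝ
    fun_prop
  have hD0 : ∀ x, ‖x‖ ≤ 1 → 0 < D x := fun x hx => by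
    rcases hx.lt_or_eq with h | h
    · have h2 : 0 < 1 - ‖x‖ ^ 2 := by nlinarith [norm_nonneg x]
      have := mul_pos (hu0 x hx) h2
      have := sq_nonneg (inner ℝ x (u x))
      simp only [D]
      linarith
    · simp only [D, h]
      have := hxu x h
      norm_num
      positivity
  let s : E → ℝ := fun x => (√(D x) - inner ℝ x (u x)) / ‖u x‖ ^ 2
  refine no_contDiffOn_retraction_closedBall (r := fun x => x + s x • u x) ?_ ?_ ?_
  · refine contDiffOn_id.add (ContDiffOn.smul ?_ hu.contDiffOn)
    refine ContDiffOn.div ?_ (hu.norm_sq ℝ).contDiffOn fun x hx => (hu0 x (by simpa using hx)).ne'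
    exact (hD.contDiffOn.sqrt fun x hx => (hD0 x (by simpa using hx)).ne').sub
      (contDiff_id.inner ℝ hu).contDiffOn
  · intro x hx
    have hs : s x * ‖u x‖ ^ 2 = √(D x) - inner ℝ x (u x) := div_mul_cancel₀ _ (hu0 x hx).ne'
    have hsq : √(D x) ^ 2 = inner ℝ x (u x) ^ 2 + ‖u x‖ ^ 2 * (1 - ‖x‖ ^ 2) :=
      Real.sq_sqrt (hD0 x hx).le
    have hsq' : (s x * ‖u x‖ ^ 2 + inner ℝ x (u x)) ^ 2 =
        inner ℝ x (u x) ^ 2 + ‖u x‖ ^ 2 * (1 - ‖x‖ ^ 2) := by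
      rw [hs, sub_add_cancel, hsq]
    have h2 : ‖x + s x • u x‖ ^ 2 = 1 := by
      rw [norm_add_sq_real, inner_smul_right, norm_smul, mul_pow, Real.norm_eq_abs, sq_abs]
      apply mul_left_cancel₀ (hu0 x hx).ne'
      linear_combination hsq'
    exact (pow_eq_one_iff_of_nonneg (norm_nonneg _) two_ne_zero).1 h2
  · intro x hx
    have : s x = 0 := by
      simp [s, D, hx, Real.sqrt_sq (hxu x hx).le]
    simp [this]

/-- A form of Brouwer's fixed point theorem. -/
theorem exists_fixedPoint_of_continuous [NormedAddCommGroup E] [InnerProductSpace ℝ E]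
    [FiniteDimensional ℝ E] {f : E → E} (hf : Continuous f) (h1 : ∀ x, ‖x‖ ≤ 1 → ‖f x‖ < 1) :
    ∃ x, ‖x‖ ≤ 1 ∧ f x = x := by
  by_contra! hne
  obtain ⟨x₀, hx₀, hmin⟩ := (isCompact_closedBall (0 : E) 1).exists_isMinOn ⟨0, by simp⟩
    (f := fun x => min (1 - ‖f x‖) ‖f x - x‖) (by fun_prop)
  have hη : 0 < min (1 - ‖f x₀‖) ‖f x₀ - x₀‖ := by
    have hx : ‖x₀‖ ≤ 1 := by simpa using hx₀
    exact lt_min (sub_pos.2 (h1 _ hx)) (norm_pos_iff.2 (sub_ne_zero.2 (hne _ hx)))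
  obtain ⟨g, hg, hgf⟩ : ∃ g : E → E, ContDiff ℝ 1 g ∧
      ∀ x, dist (g x) (f x) < min (1 - ‖f x₀‖) ‖f x₀ - x₀‖ := by
    obtain ⟨g, hgc, hg, -⟩ := hf.exists_contDiff_approx 1
      (ε := fun _ => min (1 - ‖f x₀‖) ‖f x₀ - x₀‖) continuous_const (fun _ => hη)
    exact ⟨g, hgc, hg⟩
  have hlt : ∀ x, ‖x‖ ≤ 1 → ‖g x - f x‖ < 1 - ‖f x‖ ∧ ‖g x - f x‖ < ‖f x - x‖ := fun x hx => by
    rw [← dist_eq_norm]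
    exact lt_min_iff.1 ((hgf x).trans_le (hmin (by simpa using hx)))
  obtain ⟨x, hx, hgx⟩ := exists_fixedPoint_of_contDiff hg fun x hx => by
    have h2 := norm_sub_norm_le (g x) (f x)
    linarith [(hlt x hx).1]
  have h2 := (hlt x hx).2
  rw [hgx, norm_sub_rev] at h2
  exact h2.false

end Brouwer

/-- if a continuous map `F : ℝᵏ → ℝᵏ` moves every point of the closed
unit ball by less than `ε < 1`, then the closed ball of radius `1 − ε` is contained
in the image of the closed unit ball under `F`. -/
theorem ball_in_image_of_small_displacement (k : ℕ) (hk : 1 ≤ k)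
    (F : EuclideanSpace ℝ (Fin k) → EuclideanSpace ℝ (Fin k))
    (hF : Continuous F) (ε : ℝ) (hε₀ : 0 ≤ ε) (hε₁ : ε < 1)
    (h : ∀ z : EuclideanSpace ℝ (Fin k), ‖z‖ ≤ 1 → ‖z - F z‖ < ε) :
    ∀ w : EuclideanSpace ℝ (Fin k), ‖w‖ ≤ 1 - ε →
      ∃ z : EuclideanSpace ℝ (Fin k), ‖z‖ ≤ 1 ∧ F z = w := by
  intro w hw
  obtain ⟨z, hz, hfz⟩ := exists_fixedPoint_of_continuous (f := fun z => w + (z - F z))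
    (by fun_prop) fun z hz => by linarith [norm_add_le w (z - F z), h z hz]
  refine ⟨z, hz, ?_⟩
  have h2 : w + z = z + F z := by rw [← sub_eq_iff_eq_add, ← add_sub_assoc']; exact hfz
  rw [add_comm] at h2
  exact (add_left_cancel h2).symm
end
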